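/- arXiv:1511.01567 — 2 statements merged into one kernel-verified Lean document; each statement's English description precedes it below -/
import Mathlib

section
/- Quantum alternation is not monotone with respect to the Löwner order on superoperators: for every n ≥ 1, every pair of unitary 2^n × 2^n complex matrices U and V, and every positive semidefinite matrix ρ on ℂ² ⊗ ℂ^(2^n) written in 2×2 block form ρ = [[A, B], [B†, D]] with B ≠ 0, the block matrix [[0, U B V†], [V B† U†, V D V†]] is not positive semidefinite. (This matrix is the difference (𝒮 ∙ 𝒯)(ρ) − (𝒮 ∙ ∅)(ρ), where 𝒮 = {U}, 𝒯 = {V}; since ∅ ⊑ 𝒯 and 𝒮 ⊑ 𝒮 in the Löwner order but 𝒮 ∙ ∅ ⋢ 𝒮 ∙ 𝒯, monotonicity fails.) -/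
open Matrix
open scoped ComplexOrder

/-- A positive semidefinite matrix vanishes along every row whose diagonal entry vanishes. -/
theorem Matrix.PosSemidef.apply_eq_zero_of_diag_eq_zero {ι : Type*} {M : Matrix ι ι ℂ}
    (hM : M.PosSemidef) {i : ι} (hi : M i i = 0) (j : ι) : M i j = 0 := by
  have hdet := (hM.submatrix ![i, j]).det_nonneg
  have hij : M j i = star (M i j) := (hM.isHermitian.apply j i).symm
  simp only [det_fin_two, submatrix_apply, cons_val_zero, cons_val_one, hi, hij, zero_mul,
    zero_sub, Left.nonneg_neg_iff] at hdet
  exact (CStarRing.mul_star_self_eq_zero_iff _).mp (le_antisymm hdet (mul_star_self_nonneg _))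

/-- The off-diagonal block of a positive semidefinite matrix with zero upper-left block is zero. -/
theorem Matrix.PosSemidef.fromBlocks_zero_right_eq_zero {m n : Type*} {B : Matrix m n ℂ}
    {C : Matrix n m ℂ} {D : Matrix n n ℂ} (h : (fromBlocks 0 B C D).PosSemidef) : B = 0 := by
  ext i j
  exact h.apply_eq_zero_of_diag_eq_zero (i := Sum.inl i) rfl (Sum.inr j)

/-- Quantum alternation is not monotone with respect to the Löwner order: for any unitaries
`U V` on `ℂ^(2^n)` and any positive semidefinite `ρ = [[A, B], [Bᴴ, D]]` on `ℂ² ⊗ ℂ^(2^n)`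
with `B ≠ 0`, the matrix `(𝒮 ∙ 𝒯)(ρ) − (𝒮 ∙ ∅)(ρ) = [[0, U B Vᴴ], [V Bᴴ Uᴴ, V D Vᴴ]]`
(where `𝒮 = {U}`, `𝒯 = {V}`) is not positive semidefinite, even though `𝒮 ⊑ 𝒮` and
`∅ ⊑ 𝒯` in the Löwner order. -/
theorem alternation_not_monotone (n : ℕ) (hn : 1 ≤ n)
    (U V : Matrix (Fin (2 ^ n)) (Fin (2 ^ n)) ℂ)
    (hU : U ∈ Matrix.unitaryGroup (Fin (2 ^ n)) ℂ)
    (hV : V ∈ Matrix.unitaryGroup (Fin (2 ^ n)) ℂ)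
    (A B D : Matrix (Fin (2 ^ n)) (Fin (2 ^ n)) ℂ)
    (hρ : (Matrix.fromBlocks A B Bᴴ D).PosSemidef)
    (hB : B ≠ 0) :
    ¬ (Matrix.fromBlocks 0 (U * B * Vᴴ) (V * Bᴴ * Uᴴ) (V * D * Vᴴ)).PosSemidef := by
  intro h
  have hzero : U * B * Vᴴ = 0 := h.fromBlocks_zero_right_eq_zero
  have hU' : Uᴴ * U = 1 := mem_unitaryGroup_iff'.mp hU
  have hV' : Vᴴ * V = 1 := mem_unitaryGroup_iff'.mp hV
  apply hB
  calc B = (Uᴴ * U) * B * (Vᴴ * V) := by rw [hU', hV', Matrix.one_mul, Matrix.mul_one]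
    _ = Uᴴ * (U * B * Vᴴ) * V := by simp only [Matrix.mul_assoc]
    _ = 0 := by rw [hzero, Matrix.mul_zero, Matrix.zero_mul]
end

section
/- A Stinespring representation can be constructed from any Kraus decomposition: let 𝒮 be a finite set of complex matrices E : ℂ^h → ℂ^k (so 𝒮 defines the superoperator T(ρ) = Σ_{E∈𝒮} E ρ E†), let 𝒜 = ℂ^𝒮 with orthonormal basis {|E⟩ : E ∈ 𝒮}, and define V : ℂ^k → ℂ^h ⊗ 𝒜 by V ψ = Σ_{E∈𝒮} (E† ψ) ⊗ |E⟩. Then for every h×h matrix ρ, V† (ρ ⊗ I_𝒜) V = Σ_{E∈𝒮} E ρ E† = T(ρ). -/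
open Matrix Kronecker

/-- A Stinespring representation can be constructed from any Kraus decomposition: for a
finite set `𝒮` of matrices `E : ℂ^h → ℂ^k`, with ancilla `𝒜 = ℂ^𝒮` (coordinates indexed
by the elements of `𝒮`) and `V : ℂ^k → ℂ^h ⊗ 𝒜` given by `V ψ = Σ_{E∈𝒮} (Eᴴ ψ) ⊗ |E⟩`,
one has `Vᴴ (ρ ⊗ I_𝒜) V = Σ_{E∈𝒮} E ρ Eᴴ` for every `h×h` matrix `ρ`. -/
theorem stinespring_from_kraus (h k : ℕ)
    [DecidableEq (Matrix (Fin k) (Fin h) ℂ)]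
    (S : Finset (Matrix (Fin k) (Fin h) ℂ))
    (V : Matrix (Fin h × {E // E ∈ S}) (Fin k) ℂ)
    (hV : V = Matrix.of fun p j => ((p.2 : Matrix (Fin k) (Fin h) ℂ)ᴴ) p.1 j)
    (ρ : Matrix (Fin h) (Fin h) ℂ) :
    Vᴴ * (ρ ⊗ₖ (1 : Matrix {E // E ∈ S} {E // E ∈ S} ℂ)) * V =
      ∑ E ∈ S, E * ρ * Eᴴ := by
  subst hV
  rw [← Finset.sum_coe_sort S fun E => E * ρ * Eᴴ]
  ext i j
  simp [mul_apply, Matrix.sum_apply, Fintype.sum_prod_type_right, one_apply]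
end
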